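/- Saturation for cylindric Kostka coefficients: for a cylindric diagram D, a weight nu, and a positive integer k, the set CSSYT(kD, k*nu) is nonempty if and only if CSSYT(D, nu) is nonempty, where kD is the cylindric diagram obtained by horizontally subdividing each box of D into k boxes. -/

import Mathlib

/-!
STATEMENT 16: Saturation of cylindric Kostka coefficients.
A cylindric diagram on the cylinder `C_{x,y}` is encoded by two boundary
loops `lam, mu : ℤ → ℤ` (weakly increasing, with `f (i + y) = f i + x`),
the cells in row `i` being the columns `mu i < j ≤ lam i`.  A cylindric
semistandard Young tableau is a periodic filling of the cells by positive
integers, weakly increasing along rows and strictly increasing up columns;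
its weight records the number of entries of each value in one fundamental
domain (rows `0 ≤ i < y`).  The `k`-fold horizontal stretch `kD` lives on
`C_{kx, y}` and has boundary loops `k·lam`, `k·mu`.  The theorem:
`CSSYT(kD, k·nu)` is nonempty iff `CSSYT(D, nu)` is nonempty.
-/

/-- `(i,j)` is a cell of the cylindric diagram with boundaries `lam`, `mu`. -/
def CylCell (lam mu : ℤ → ℤ) (c : ℤ × ℤ) : Prop :=
  mu c.1 < c.2 ∧ c.2 ≤ lam c.1

/-- `T` is a cylindric semistandard Young tableau on `C_{x,y}` of shape
`lam/mu` and weight `nu`. -/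
def IsCylSSYT (x y : ℕ) (lam mu : ℤ → ℤ) (nu : ℕ → ℕ) (T : ℤ × ℤ → ℕ) : Prop :=
  (∀ c, ¬ CylCell lam mu c → T c = 0) ∧
  (∀ i j : ℤ, T (i + y, j + x) = T (i, j)) ∧
  (∀ c, CylCell lam mu c → 0 < T c) ∧
  -- rows weakly increase
  (∀ i j : ℤ, CylCell lam mu (i, j) → CylCell lam mu (i, j + 1) →
    T (i, j) ≤ T (i, j + 1)) ∧
  -- columns strictly increase (upwards)
  (∀ i j : ℤ, CylCell lam mu (i, j) → CylCell lam mu (i + 1, j) →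
    T (i + 1, j) < T (i, j)) ∧
  -- weight
  (∀ v : ℕ, 0 < v →
    Nat.card {c : ℤ × ℤ // 0 ≤ c.1 ∧ c.1 < (y : ℤ) ∧ CylCell lam mu c ∧ T c = v}
      = nu v)

/-- Sum of a boundary loop over one period. -/
def loopSum (y : ℕ) (f : ℤ → ℤ) : ℤ := ∑ i ∈ Finset.range y, f i

/-- A chain of interlacing loops from `mu` to `lam`, constant from index `n` on. -/
structure LoopChain (x y : ℕ) (lam mu : ℤ → ℤ) (n : ℕ) (a : ℕ → ℤ → ℤ) : Prop where
  zero : ∀ i, a 0 i = mu i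
  top : ∀ v, n ≤ v → ∀ i, a v i = lam i
  le_succ : ∀ v i, a v i ≤ a (v + 1) i
  succ_le : ∀ v i, a (v + 1) i ≤ a v (i + 1)
  periodic : ∀ v i, a v (i + y) = a v i + x

/-- `t` is the sequence of level sums of some chain of loops. -/
def ChainSums (x y : ℕ) (lam mu : ℤ → ℤ) (n : ℕ) (t : ℕ → ℤ) : Prop :=
  ∃ a, LoopChain x y lam mu n a ∧ ∀ v, loopSum y (a v) = t v

theorem loopSum_mono (y : ℕ) {f g : ℤ → ℤ} (h : ∀ i, f i ≤ g i) :
    loopSum y f ≤ loopSum y g :=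
  Finset.sum_le_sum fun i _ => h i

theorem loopSum_mul (y : ℕ) (k : ℤ) (f : ℤ → ℤ) :
    loopSum y (fun i => k * f i) = k * loopSum y f := by
  simp [loopSum, Finset.mul_sum]

theorem loopSum_shift (x y : ℕ) {f : ℤ → ℤ} (h : ∀ i, f (i + y) = f i + x) :
    loopSum y (fun i => f (i + 1)) = loopSum y f + x := by
  have h1 := Finset.sum_range_succ (fun i : ℕ => f i) y
  have h2 := Finset.sum_range_succ' (fun i : ℕ => f i) y
  have h3 := h 0
  simp only [zero_add] at h3
  push_cast at h2
  simp only [loopSum]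
  linarith

theorem periodic_emod (x y : ℕ) {f : ℤ → ℤ} (h : ∀ i, f (i + y) = f i + x) (i : ℤ) :
    f i = f (i % y) + x * (i / y) := by
  have key : ∀ (m : ℤ) (j : ℤ), f (j + y * m) = f j + x * m := by
    intro m
    induction m using Int.induction_on with
    | zero => simp
    | succ m ih =>
      intro j
      have := h (j + y * m)
      rw [show j + y * ((m : ℤ) + 1) = j + y * m + y by ring, this, ih]
      ring
    | pred m ih =>
      intro j
      have := h (j + y * (-m - 1))
      rw [show j + y * (-(m : ℤ) - 1) + y = j + y * (-m) by ring, ih] at this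
      linarith
  conv_lhs => rw [← Int.emod_add_mul_ediv i y]
  exact key _ _

theorem exists_sum_eq_of_between (y : ℕ) (lo hi : ℕ → ℤ) (h : ∀ i, lo i ≤ hi i) (m : ℤ)
    (h1 : ∑ i ∈ Finset.range y, lo i ≤ m) (h2 : m ≤ ∑ i ∈ Finset.range y, hi i) :
    ∃ F : ℕ → ℤ, (∀ i, lo i ≤ F i ∧ F i ≤ hi i) ∧ ∑ i ∈ Finset.range y, F i = m := by
  induction y generalizing m with
  | zero =>
    refine ⟨lo, fun i => ⟨le_rfl, h i⟩, ?_⟩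
    simp at *
    omega
  | succ y ih =>
    rw [Finset.sum_range_succ] at h1 h2
    have hle : ∑ i ∈ Finset.range y, lo i ≤ ∑ i ∈ Finset.range y, hi i :=
      Finset.sum_le_sum fun i _ => h i
    have := h y
    obtain ⟨F, hF, hs⟩ := ih (max (∑ i ∈ Finset.range y, lo i) (m - hi y))
      (le_max_left _ _) (by omega)
    refine ⟨Function.update F y (m - ∑ i ∈ Finset.range y, F i), fun i => ?_, ?_⟩
    · by_cases hi : i = y
      · subst hi
        simp only [Function.update_self]
        omega
      · simpa [Function.update_of_ne hi] using hF i
    · rw [Finset.sum_range_succ, Function.update_self,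
        Finset.sum_congr rfl (g := F) fun i hi =>
          Function.update_of_ne (by simp at hi; omega) _ _]
      ring

theorem exists_loop_between (x y : ℕ) (hy : 0 < y) {lo hi : ℤ → ℤ} (h : ∀ i, lo i ≤ hi i)
    (hlo : ∀ i, lo (i + y) = lo i + x) (hhi : ∀ i, hi (i + y) = hi i + x) (m : ℤ)
    (h1 : loopSum y lo ≤ m) (h2 : m ≤ loopSum y hi) :
    ∃ f : ℤ → ℤ, (∀ i, lo i ≤ f i) ∧ (∀ i, f i ≤ hi i) ∧ (∀ i, f (i + y) = f i + x) ∧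
      loopSum y f = m := by
  obtain ⟨F, hF, hs⟩ := exists_sum_eq_of_between y (fun i => lo i) (fun i => hi i)
    (fun i => h i) m h1 h2
  have hy' : (y : ℤ) ≠ 0 := by omega
  have hc : ∀ i : ℤ, (((i % y).toNat : ℕ) : ℤ) = i % y := fun i =>
    Int.toNat_of_nonneg (Int.emod_nonneg _ hy')
  refine ⟨fun i => F (i % y).toNat + x * (i / y), fun i => ?_, fun i => ?_, fun i => ?_, ?_⟩
  · have := (hF (i % y).toNat).1
    simp only [hc] at this
    rw [periodic_emod x y hlo i]
    linarith
  · have := (hF (i % y).toNat).2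
    simp only [hc] at this
    rw [periodic_emod x y hhi i]
    linarith
  · simp only [Int.add_emod_right, Int.add_ediv_of_dvd_right (dvd_refl (y : ℤ)),
      Int.ediv_self hy']
    ring
  · rw [← hs]
    refine Finset.sum_congr rfl fun i hi => ?_
    have hi' : (i : ℤ) < y := by simpa using hi
    simp [Int.emod_eq_of_lt (by omega : (0 : ℤ) ≤ i) hi',
      Int.ediv_eq_zero_of_lt (by omega : (0 : ℤ) ≤ i) hi']

theorem LoopChain.mono {x y n : ℕ} {lam mu : ℤ → ℤ} {a : ℕ → ℤ → ℤ}
    (ha : LoopChain x y lam mu n a) (i : ℤ) : Monotone fun v => a v i :=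
  monotone_nat_of_le_succ fun v => ha.le_succ v i

theorem LoopChain.le_top {x y n : ℕ} {lam mu : ℤ → ℤ} {a : ℕ → ℤ → ℤ}
    (ha : LoopChain x y lam mu n a) (v : ℕ) (i : ℤ) : a v i ≤ lam i := by
  rw [← ha.top (max v n) (le_max_right _ _) i]
  exact ha.mono i (le_max_left _ _)

theorem LoopChain.le_shift {x y n : ℕ} {lam mu : ℤ → ℤ} {a : ℕ → ℤ → ℤ}
    (ha : LoopChain x y lam mu n a) (v : ℕ) (i : ℤ) : a v i ≤ mu (i + v) := by
  induction v generalizing i with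
  | zero => simp [ha.zero]
  | succ v ih =>
    have h1 := ha.succ_le v i
    have h2 := ih (i + 1)
    rw [show i + ((v + 1 : ℕ) : ℤ) = i + 1 + v by push_cast; ring]
    exact h1.trans h2

theorem ChainSums.update {x y n : ℕ} (hy : 0 < y) {lam mu : ℤ → ℤ} {t : ℕ → ℤ}
    (h : ChainSums x y lam mu n t) {v : ℕ} (hv : v + 1 < n) {m : ℤ}
    (h1 : min (t (v + 1)) (t v + t (v + 2) - t (v + 1)) ≤ m)
    (h2 : m ≤ max (t (v + 1)) (t v + t (v + 2) - t (v + 1))) :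
    ChainSums x y lam mu n (Function.update t (v + 1) m) := by
  obtain ⟨a, ha, hs⟩ := h
  set lo : ℤ → ℤ := fun i => max (a v i) (a (v + 2) (i - 1)) with hlo
  set hi : ℤ → ℤ := fun i => min (a (v + 2) i) (a v (i + 1)) with hhi
  have hloa : ∀ i, lo i ≤ a (v + 1) i := fun i =>
    max_le (ha.le_succ v i) (by simpa using ha.succ_le (v + 1) (i - 1))
  have hahi : ∀ i, a (v + 1) i ≤ hi i := fun i =>
    le_min (ha.le_succ (v + 1) i) (ha.succ_le v i)
  have hlop : ∀ i, lo (i + y) = lo i + x := fun i => by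
    simp only [hlo, ha.periodic, show i + (y : ℤ) - 1 = i - 1 + y by ring, max_add_add_right]
  have hhip : ∀ i, hi (i + y) = hi i + x := fun i => by
    simp only [hhi, ha.periodic, show i + (y : ℤ) + 1 = i + 1 + y by ring, min_add_add_right]
  have hsum : loopSum y lo + loopSum y hi = t v + t (v + 2) := by
    have e1 := loopSum_shift x y hlop
    have e2 := loopSum_shift x y (ha.periodic v)
    have e3 : loopSum y (fun i => lo (i + 1)) + loopSum y hi =
        loopSum y (fun i => a v (i + 1)) + loopSum y (a (v + 2)) := by
      simp only [loopSum, ← Finset.sum_add_distrib]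
      refine Finset.sum_congr rfl fun i _ => ?_
      simp only [hlo, hhi, add_sub_cancel_right]
      omega
    rw [← hs v, ← hs (v + 2)]
    linarith
  have l1 := loopSum_mono y hloa
  have l2 := loopSum_mono y hahi
  rw [hs] at l1 l2
  obtain ⟨f, hf1, hf2, hfp, hfs⟩ := exists_loop_between x y hy
    (fun i => (hloa i).trans (hahi i)) hlop hhip m (by omega) (by omega)
  refine ⟨Function.update a (v + 1) f, ⟨fun i => ?_, fun w hw i => ?_, fun w i => ?_,
    fun w i => ?_, fun w i => ?_⟩, fun w => ?_⟩
  · rw [Function.update_of_ne (by omega)]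
    exact ha.zero i
  · rw [Function.update_of_ne (by omega)]
    exact ha.top w hw i
  · rcases eq_or_ne w v with rfl | h1
    · rw [Function.update_of_ne (by omega), Function.update_self]
      exact (le_max_left _ _).trans (hf1 i)
    · rcases eq_or_ne w (v + 1) with rfl | h2
      · rw [Function.update_self, Function.update_of_ne (by omega)]
        exact (hf2 i).trans (min_le_left _ _)
      · rw [Function.update_of_ne h2, Function.update_of_ne (by omega)]
        exact ha.le_succ w i
  · rcases eq_or_ne w v with rfl | h1
    · rw [Function.update_of_ne (by omega : w ≠ w + 1), Function.update_self]
      exact (hf2 i).trans (min_le_right _ _)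
    · rcases eq_or_ne w (v + 1) with rfl | h2
      · rw [Function.update_of_ne (by omega), Function.update_self]
        have := (le_max_right _ _).trans (hf1 (i + 1))
        simpa using this
      · rw [Function.update_of_ne h2, Function.update_of_ne (by omega)]
        exact ha.succ_le w i
  · rcases eq_or_ne w (v + 1) with rfl | h2
    · simpa using hfp i
    · rw [Function.update_of_ne h2]
      exact ha.periodic w i
  · rcases eq_or_ne w (v + 1) with rfl | h2
    · simpa using hfs
    · rw [Function.update_of_ne h2, Function.update_of_ne h2]
      exact hs w

theorem sum_range_update {n w : ℕ} (hw : w < n) (f : ℕ → ℤ) (m : ℤ) :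
    ∑ v ∈ Finset.range n, Function.update f w m v = ∑ v ∈ Finset.range n, f v + (m - f w) := by
  have hmem := Finset.mem_range.2 hw
  rw [Finset.sum_update_of_mem hmem, ← Finset.add_sum_erase _ f hmem,
    Finset.sdiff_singleton_eq_erase]
  ring

/-- A nonnegative sequence that vanishes at the ends and is convex where positive is zero. -/
theorem eq_zero_of_convex_where_pos {n : ℕ} {d : ℕ → ℤ} (h0 : d 0 = 0) (hn : ∀ v, n ≤ v → d v = 0)
    (hd : ∀ v, 0 ≤ d v) (hc : ∀ v, 0 < d (v + 1) → 2 * d (v + 1) ≤ d v + d (v + 2)) (v : ℕ) :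
    d v = 0 := by
  have hstep : ∀ w, d (w + 1) ≤ d w := by
    intro w
    by_contra! hlt
    have : ∀ u, d (w + u) < d (w + u + 1) := by
      intro u
      induction u with
      | zero => simpa using hlt
      | succ u ih =>
        have h1 := hd (w + u)
        have h2 := hc (w + u) (by omega)
        simp only [← add_assoc]
        rw [show w + u + 1 + 1 = w + u + 2 by ring]
        omega
    have h1 := this n
    rw [hn _ (by omega), hn _ (by omega)] at h1
    exact lt_irrefl _ h1
  have := antitone_nat_of_succ_le hstep (Nat.zero_le v)
  have := hd v
  omega

/-- Level sums above a concave sequence with the same ends can be lowered to that sequence. -/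
theorem ChainSums.of_concave_le {x y n : ℕ} (hy : 0 < y) {lam mu : ℤ → ℤ} {p t : ℕ → ℤ}
    (hp : ChainSums x y lam mu n p) (hle : ∀ v, t v ≤ p v) (h0 : t 0 = p 0)
    (hn : ∀ v, n ≤ v → t v = p v) (ht : ∀ v, t v + t (v + 2) ≤ 2 * t (v + 1)) :
    ChainSums x y lam mu n t := by
  obtain ⟨N, hN⟩ : ∃ N : ℕ, ∑ v ∈ Finset.range n, p v - ∑ v ∈ Finset.range n, t v ≤ N :=
    ⟨_, Int.self_le_toNat _⟩
  induction N generalizing p with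
  | zero =>
    have hpt : ∀ v, t v = p v := by
      intro v
      rcases lt_or_ge v n with hv | hv
      · have hs : ∑ v ∈ Finset.range n, t v = ∑ v ∈ Finset.range n, p v :=
          le_antisymm (Finset.sum_le_sum fun i _ => hle i) (by simpa using hN)
        exact (Finset.sum_eq_sum_iff_of_le fun i _ => hle i).1 hs v (by simpa using hv)
      · exact hn v hv
    rwa [funext hpt]
  | succ N ih =>
    by_cases hconv : ∀ v, 0 < p (v + 1) - t (v + 1) → 2 * (p (v + 1) - t (v + 1)) ≤
        (p v - t v) + (p (v + 2) - t (v + 2))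
    · have hpt : ∀ v, p v - t v = 0 := eq_zero_of_convex_where_pos (n := n) (by omega)
        (fun v hv => by have := hn v hv; omega) (fun v => by have := hle v; omega) hconv
      have : t = p := funext fun v => by have := hpt v; omega
      rwa [this]
    · push Not at hconv
      obtain ⟨v, hv1, hv2⟩ := hconv
      have hvn : v + 1 < n := by
        by_contra! hge
        have := hn _ hge
        omega
      have hc := ht v
      refine ih (hp.update hy hvn (m := p (v + 1) - 1) (by omega) (by omega))
        (fun w => ?_) ?_ (fun w hw => ?_) ?_
      · rcases eq_or_ne w (v + 1) with rfl | h2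
        · rw [Function.update_self]
          omega
        · rw [Function.update_of_ne h2]
          exact hle w
      · rwa [Function.update_of_ne (by omega)]
      · rw [Function.update_of_ne (by omega)]
        exact hn w hw
      · rw [sum_range_update hvn]
        push_cast at hN
        omega

theorem LoopChain.greedy {x y n : ℕ} {lam mu : ℤ → ℤ}
    (hlam : ∀ i, lam i ≤ lam (i + 1)) (hlamp : ∀ i, lam (i + y) = lam i + x)
    (hmu : ∀ i, mu i ≤ mu (i + 1)) (hmup : ∀ i, mu (i + y) = mu i + x)
    (hsub : ∀ i, mu i ≤ lam i) (hn : ∀ i, lam i ≤ mu (i + n)) :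
    LoopChain x y lam mu n fun v i => min (lam i) (mu (i + v)) where
  zero i := by simpa using hsub i
  top v hv i := by
    refine min_eq_left ((hn i).trans (monotone_int_of_le_succ hmu ?_))
    omega
  le_succ v i := min_le_min le_rfl (monotone_int_of_le_succ hmu (by push_cast; omega))
  succ_le v i := min_le_min (hlam i) (monotone_int_of_le_succ hmu (by push_cast; omega))
  periodic v i := by
    rw [hlamp, show i + (y : ℤ) + v = i + v + y by ring, hmup, min_add_add_right]

theorem ChainSums.of_mul {x y n : ℕ} (hy : 0 < y) {lam mu : ℤ → ℤ}
    (hlam : ∀ i, lam i ≤ lam (i + 1)) (hlamp : ∀ i, lam (i + y) = lam i + x)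
    (hmu : ∀ i, mu i ≤ mu (i + 1)) (hmup : ∀ i, mu (i + y) = mu i + x)
    (hsub : ∀ i, mu i ≤ lam i) {k : ℕ} (hk : 0 < k) {t : ℕ → ℤ}
    (h : ChainSums (k * x) y (fun i => k * lam i) (fun i => k * mu i) n fun v => k * t v) :
    ChainSums x y lam mu n t := by
  have hk' : (0 : ℤ) < k := by exact_mod_cast hk
  have hbound : ∀ {t : ℕ → ℤ}, ChainSums (k * x) y (fun i => k * lam i) (fun i => k * mu i) n
      (fun v => k * t v) → ∀ v, t v ≤ loopSum y lam := by
    rintro t ⟨a, ha, hs⟩ v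
    have := loopSum_mono y (ha.le_top v)
    rw [hs, loopSum_mul] at this
    exact le_of_mul_le_mul_left this hk'
  obtain ⟨N, hN⟩ : ∃ N : ℕ, ∑ v ∈ Finset.range n, (loopSum y lam - t v) ≤ N :=
    ⟨_, Int.self_le_toNat _⟩
  induction N using Nat.strong_induction_on generalizing t with
  | _ N ih =>
    obtain ⟨a, ha, hs⟩ := id h
    have hle := hbound h
    have htop : ∀ v, n ≤ v → t v = loopSum y lam := fun v hv => by
      have := hs v
      rw [funext (ha.top v hv), loopSum_mul] at this
      exact (mul_left_cancel₀ hk'.ne' this).symm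
    have hzero : t 0 = loopSum y mu := by
      have := hs 0
      rw [funext ha.zero, loopSum_mul] at this
      exact (mul_left_cancel₀ hk'.ne' this).symm
    by_cases hc : ∀ v, t v + t (v + 2) ≤ 2 * t (v + 1)
    · have hn : ∀ i, lam i ≤ mu (i + n) := fun i => by
        have := ha.le_shift n i
        rw [ha.top n le_rfl] at this
        exact le_of_mul_le_mul_left this hk'
      have hg := LoopChain.greedy hlam hlamp hmu hmup hsub hn
      refine ChainSums.of_concave_le hy ⟨_, hg, fun v => rfl⟩ (fun v => ?_) ?_
        (fun v hv => ?_) hc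
      · have : loopSum y (a v) ≤ loopSum y (fun i => k * min (lam i) (mu (i + v))) :=
          loopSum_mono y fun i => by
            rw [mul_min_of_nonneg _ _ hk'.le]
            exact le_min (ha.le_top v i) (ha.le_shift v i)
        rw [hs, loopSum_mul] at this
        exact le_of_mul_le_mul_left this hk'
      · rw [hzero, funext hg.zero]
      · rw [htop v hv, funext (hg.top v hv)]
    · push Not at hc
      obtain ⟨v, hv⟩ := hc
      have hvn : v + 1 < n := by
        by_contra! hge
        have h1 := htop _ hge
        have h2 := htop (v + 2) (by omega)
        have h3 := hle v
        omega
      set m := t v + t (v + 2) - t (v + 1) with hm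
      have hupd : (fun w => (k : ℤ) * Function.update t (v + 1) m w) =
          Function.update (fun w => (k : ℤ) * t w) (v + 1) (k * m) := by
        funext w
        rcases eq_or_ne w (v + 1) with rfl | h2
        · simp
        · simp [Function.update_of_ne h2]
      have hkm : (k : ℤ) * m = k * t v + k * t (v + 2) - k * t (v + 1) := by
        rw [hm]
        ring
      have h' : ChainSums (k * x) y (fun i => k * lam i) (fun i => k * mu i) n
          fun w => k * Function.update t (v + 1) m w := by
        rw [hupd]
        exact h.update hy hvn (hkm ▸ min_le_right _ _) (hkm ▸ le_max_right _ _)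
      have hsum := sum_range_update hvn t m
      have hpos : 0 ≤ ∑ w ∈ Finset.range n, (loopSum y lam - Function.update t (v + 1) m w) :=
        Finset.sum_nonneg fun w _ => sub_nonneg.2 (hbound h' w)
      have hlt : ∑ w ∈ Finset.range n, (loopSum y lam - Function.update t (v + 1) m w) < N := by
        rw [Finset.sum_sub_distrib] at hN ⊢
        omega
      have hD := (ih _ (by omega) h' (Int.self_le_toNat _)).update hy hvn (m := t (v + 1))
        (by simp [hm]) (by simp [hm])
      simpa using hD

/-- A weakly increasing row is cut by a value `v` at some position `b`. -/
theorem exists_cut (f : ℤ → ℕ) (v : ℕ) {m l : ℤ} (h : m ≤ l)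
    (hf : ∀ j, m < j → j + 1 ≤ l → f j ≤ f (j + 1)) :
    ∃ b, m ≤ b ∧ b ≤ l ∧ ∀ j, m < j → j ≤ l → (f j ≤ v ↔ j ≤ b) := by
  induction l, h using Int.leInduction with
  | base => exact ⟨m, le_rfl, le_rfl, fun j _ _ => by omega⟩
  | succ l hl ih =>
    obtain ⟨b, hb1, hb2, hb⟩ := ih fun j h1 h2 => hf j h1 (by omega)
    by_cases hv : f (l + 1) ≤ v
    · refine ⟨l + 1, by omega, le_rfl, fun j h1 h2 => iff_of_true ?_ h2⟩
      rcases eq_or_lt_of_le h2 with rfl | h3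
      · exact hv
      · have hbl : b = l := by
          by_contra hne
          have h4 := hb l (by omega) le_rfl
          have h5 := hf l (by omega) le_rfl
          omega
        exact (hb j h1 (by omega)).2 (by omega)
    · refine ⟨b, hb1, by omega, fun j h1 h2 => ?_⟩
      rcases eq_or_lt_of_le h2 with rfl | h3
      · exact iff_of_false hv (by omega)
      · exact hb j h1 (by omega)

theorem card_cells (y : ℕ) (A B : ℤ → ℤ) (h : ∀ i, A i ≤ B i) :
    (Nat.card {c : ℤ × ℤ // 0 ≤ c.1 ∧ c.1 < (y : ℤ) ∧ A c.1 < c.2 ∧ c.2 ≤ B c.1} : ℤ) =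
      loopSum y B - loopSum y A := by
  let e : {c : ℤ × ℤ // 0 ≤ c.1 ∧ c.1 < (y : ℤ) ∧ A c.1 < c.2 ∧ c.2 ≤ B c.1} ≃
      Σ i : Fin y, Finset.Ioc (A (i : ℕ)) (B (i : ℕ)) :=
    { toFun := fun c => ⟨⟨c.1.1.toNat, by have := c.2; omega⟩, ⟨c.1.2, by
        have := c.2
        simpa [Int.toNat_of_nonneg this.1] using this.2.2⟩⟩
      invFun := fun s => ⟨((s.1 : ℕ), s.2.1), by
        have h1 := Finset.mem_Ioc.1 s.2.2
        exact ⟨by simp, by simp, h1.1, h1.2⟩⟩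
      left_inv := fun c => by
        have := c.2.1
        ext <;> simp [this]
      right_inv := fun s => by
        rcases s with ⟨i, j, hj⟩
        simp }
  rw [Nat.card_congr e, Nat.card_eq_fintype_card, Fintype.card_sigma]
  simp only [Fintype.card_coe, Int.card_Ioc, loopSum, ← Finset.sum_sub_distrib]
  rw [Fin.sum_univ_eq_sum_range (fun i : ℕ => (B i - A i).toNat) y, Nat.cast_sum]
  exact Finset.sum_congr rfl fun i _ => Int.toNat_of_nonneg (by have := h i; omega)

theorem IsCylSSYT.bounded {x y : ℕ} (hy : 0 < y) {lam mu : ℤ → ℤ} {nu : ℕ → ℕ} {T : ℤ × ℤ → ℕ}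
    (hT : IsCylSSYT x y lam mu nu T) : ∃ n, ∀ c, T c ≤ n := by
  obtain ⟨hzero, hper, -⟩ := hT
  have hy' : (0 : ℤ) < y := by exact_mod_cast hy
  let s : Finset (ℤ × ℤ) := (Finset.Ico (0 : ℤ) y).biUnion fun i =>
    (Finset.Ioc (mu i) (lam i)).image fun j => (i, j)
  have hs : ∀ c, T c ≤ s.sup T ∨ ¬ (0 ≤ c.1 ∧ c.1 < y) := by
    rintro ⟨i, j⟩
    by_cases hi : 0 ≤ i ∧ i < (y : ℤ)
    · left
      by_cases hc : CylCell lam mu (i, j)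
      · refine Finset.le_sup (f := T) ?_
        simpa [s, hi, CylCell] using hc
      · simp [hzero _ hc]
    · exact Or.inr hi
  refine ⟨s.sup T, fun c => ?_⟩
  have hmod : ∀ (m : ℤ) (i j : ℤ), T (i + y * m, j + x * m) = T (i, j) := by
    intro m
    induction m using Int.induction_on with
    | zero => simp
    | succ m ih =>
      intro i j
      rw [← ih i j, ← hper (i + y * m)]
      ring_nf
    | pred m ih =>
      intro i j
      rw [← ih i j, ← hper (i + y * (-m - 1))]
      ring_nf
  have h1 := hs (c.1 % y, c.2 - x * (c.1 / y))
  have h2 := hmod (c.1 / y) (c.1 % y) (c.2 - x * (c.1 / y))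
  rw [Int.emod_add_mul_ediv, sub_add_cancel] at h2
  rw [← h2] at h1
  refine h1.resolve_right (not_not.2 ⟨Int.emod_nonneg _ hy'.ne', Int.emod_lt_of_pos _ hy'⟩)

/-- Level sums prescribed by a weight. -/
def weightSums (y : ℕ) (mu : ℤ → ℤ) (nu : ℕ → ℕ) (v : ℕ) : ℤ :=
  loopSum y mu + ∑ w ∈ Finset.range v, (nu (w + 1) : ℤ)

theorem IsCylSSYT.exists_chainSums {x y : ℕ} (hy : 0 < y) {lam mu : ℤ → ℤ}
    (hlam : ∀ i, lam i ≤ lam (i + 1)) (hlamp : ∀ i, lam (i + y) = lam i + x)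
    (hmu : ∀ i, mu i ≤ mu (i + 1)) (hmup : ∀ i, mu (i + y) = mu i + x)
    (hsub : ∀ i, mu i ≤ lam i) {nu : ℕ → ℕ} {T : ℤ × ℤ → ℕ} (hT : IsCylSSYT x y lam mu nu T) :
    ∃ n, ChainSums x y lam mu n (weightSums y mu nu) := by
  obtain ⟨n, hn⟩ := hT.bounded hy
  obtain ⟨hzero, hper, hpos, hrow, hcol, hwt⟩ := hT
  have hcut : ∀ (v : ℕ) (i : ℤ), ∃ b, mu i ≤ b ∧ b ≤ lam i ∧
      ∀ j, mu i < j → j ≤ lam i → (T (i, j) ≤ v ↔ j ≤ b) := fun v i =>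
    exists_cut (fun j => T (i, j)) v (hsub i) fun j h1 h2 =>
      hrow i j ⟨h1, by simp only; omega⟩ ⟨by simp only; omega, h2⟩
  choose a ha1 ha2 ha using hcut
  have hsucc : ∀ v i, a v i ≤ a (v + 1) i := fun v i => by
    by_contra! hlt
    have h1 := ha1 (v + 1) i
    have h2 := ha2 v i
    have h3 := ha v i (a v i) (by omega) h2
    have h4 := ha (v + 1) i (a v i) (by omega) h2
    omega
  have ha0 : ∀ i, a 0 i = mu i := fun i => by
    by_contra hne
    have h1 := ha1 0 i
    have h2 := ha2 0 i
    have h3 := ha 0 i (a 0 i) (by omega) h2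
    have h4 := hpos (i, a 0 i) ⟨by simp only; omega, h2⟩
    omega
  refine ⟨n, a, ⟨ha0, fun v hv i => ?_, hsucc, fun v i => ?_, fun v i => ?_⟩, fun v => ?_⟩
  · by_contra hne
    have h1 := ha1 v i
    have h2 := ha2 v i
    have h3 := ha v i (lam i) (by omega) le_rfl
    have h4 := hn (i, lam i)
    omega
  · by_contra! hlt
    have h1 := ha1 v (i + 1)
    have h2 := ha2 (v + 1) i
    have h3 := hlam i
    have h4 := hmu i
    have h5 := ha (v + 1) i (a (v + 1) i) (by omega) h2
    have h6 := ha v (i + 1) (a (v + 1) i) (by omega) (by omega)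
    have h7 := hcol i (a (v + 1) i) ⟨by simp only; omega, h2⟩
      ⟨by simp only; omega, by simp only; omega⟩
    omega
  · have p1 := hlamp i
    have p2 := hmup i
    have h1 := ha1 v i
    have h2 := ha2 v i
    have h3 := ha1 v (i + y)
    have h4 := ha2 v (i + y)
    rcases lt_trichotomy (a v (i + y)) (a v i + x) with h | h | h
    · have h5 := ha v i (a v i) (by omega) h2
      have h6 := ha v (i + y) (a v i + x) (by omega) (by omega)
      rw [hper] at h6
      omega
    · exact h
    · have h5 := ha v i (a v (i + y) - x) (by omega) (by omega)
      have h6 := ha v (i + y) (a v (i + y) - x + x) (by omega) (by omega)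
      rw [hper] at h6
      omega
  · induction v with
    | zero => simp [weightSums, funext ha0]
    | succ v ih =>
      have h1 := card_cells y (a v) (a (v + 1)) (hsucc v)
      have h2 := hwt (v + 1) v.succ_pos
      have h3 : ∀ c : ℤ × ℤ, (0 ≤ c.1 ∧ c.1 < (y : ℤ) ∧ CylCell lam mu c ∧ T c = v + 1) ↔
          (0 ≤ c.1 ∧ c.1 < (y : ℤ) ∧ a v c.1 < c.2 ∧ c.2 ≤ a (v + 1) c.1) := by
        rintro ⟨i, j⟩
        have g1 := ha v i j
        have g2 := ha (v + 1) i j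
        have g3 := ha1 v i
        have g4 := ha2 (v + 1) i
        simp only [CylCell]
        omega
      rw [Nat.card_congr (Equiv.subtypeEquivRight h3)] at h2
      rw [h2] at h1
      simp only [weightSums, Finset.sum_range_succ] at ih ⊢
      linarith

open Classical in
theorem ChainSums.exists_isCylSSYT {x y n : ℕ} {lam mu : ℤ → ℤ} {nu : ℕ → ℕ}
    (hlamp : ∀ i, lam (i + y) = lam i + x) (hmup : ∀ i, mu (i + y) = mu i + x)
    (h : ChainSums x y lam mu n (weightSums y mu nu)) : ∃ T, IsCylSSYT x y lam mu nu T := by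
  obtain ⟨a, ha, hs⟩ := h
  let T : ℤ × ℤ → ℕ := fun c => if CylCell lam mu c then sInf {v | c.2 ≤ a v c.1} else 0
  have hT : ∀ i j, CylCell lam mu (i, j) → ∀ v, T (i, j) ≤ v ↔ j ≤ a v i := by
    intro i j hc v
    simp only [T, if_pos hc]
    refine ⟨fun h => ?_, fun h => Nat.sInf_le h⟩
    have hne : {v | j ≤ a v i}.Nonempty := ⟨n, by
      simp only [Set.mem_ofPred_eq, ha.top n le_rfl]
      exact hc.2⟩
    exact (Nat.sInf_mem hne).trans (ha.mono i h)
  have hpos : ∀ c, CylCell lam mu c → 0 < T c := by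
    rintro ⟨i, j⟩ hc
    by_contra! h
    have := (hT i j hc 0).1 h
    rw [ha.zero] at this
    exact absurd hc.1 (not_lt.2 this)
  refine ⟨T, fun c hc => if_neg hc, fun i j => ?_, hpos, fun i j h1 h2 => ?_,
    fun i j h1 h2 => ?_, fun v hv => ?_⟩
  · simp only [T, CylCell, hlamp, hmup, ha.periodic, add_lt_add_iff_right, add_le_add_iff_right]
    congr
  · rw [hT i j h1]
    have := (hT i (j + 1) h2 _).1 le_rfl
    omega
  · have h3 := hpos _ h1
    have h4 : T (i + 1, j) ≤ T (i, j) - 1 := by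
      rw [hT _ _ h2]
      refine le_trans ?_ (ha.succ_le _ i)
      rw [← hT _ _ h1]
      omega
    omega
  · obtain ⟨v, rfl⟩ := Nat.exists_eq_succ_of_ne_zero hv.ne'
    have h1 := card_cells y (a v) (a (v + 1)) (ha.le_succ v)
    have h3 : ∀ c : ℤ × ℤ, (0 ≤ c.1 ∧ c.1 < (y : ℤ) ∧ CylCell lam mu c ∧ T c = v + 1) ↔
        (0 ≤ c.1 ∧ c.1 < (y : ℤ) ∧ a v c.1 < c.2 ∧ c.2 ≤ a (v + 1) c.1) := by
      rintro ⟨i, j⟩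
      have g0 := ha.mono i (Nat.zero_le v)
      simp only [ha.zero] at g0
      have g3 := ha.le_top (v + 1) i
      have hiff : CylCell lam mu (i, j) ∧ T (i, j) = v + 1 ↔ a v i < j ∧ j ≤ a (v + 1) i := by
        constructor
        · rintro ⟨hc, he⟩
          have g1 := hT i j hc v
          have g2 := hT i j hc (v + 1)
          omega
        · rintro ⟨h1, h2⟩
          have hc : CylCell lam mu (i, j) := ⟨by simp only; omega, by simp only; omega⟩
          have g1 := hT i j hc v
          have g2 := hT i j hc (v + 1)
          exact ⟨hc, by omega⟩
      simp only [hiff]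
    rw [Nat.succ_eq_add_one, Nat.card_congr (Equiv.subtypeEquivRight h3)]
    rw [hs, hs] at h1
    simp only [weightSums, Finset.sum_range_succ] at h1
    have h4 : ∀ p q r : ℤ, r = p + (q + nu (v + 1)) - (p + q) → r = nu (v + 1) := by
      intros
      linarith
    exact_mod_cast h4 _ _ _ h1

theorem ChainSums.mul {x y n : ℕ} {lam mu : ℤ → ℤ} {t : ℕ → ℤ} (k : ℕ)
    (h : ChainSums x y lam mu n t) :
    ChainSums (k * x) y (fun i => k * lam i) (fun i => k * mu i) n fun v => k * t v := by
  obtain ⟨a, ha, hs⟩ := h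
  have hk : (0 : ℤ) ≤ k := Int.natCast_nonneg k
  refine ⟨fun v i => k * a v i, ⟨fun i => ?_, fun v hv i => ?_, fun v i => ?_, fun v i => ?_,
    fun v i => ?_⟩, fun v => ?_⟩
  · simp only [ha.zero]
  · simp only [ha.top v hv]
  · exact mul_le_mul_of_nonneg_left (ha.le_succ v i) hk
  · exact mul_le_mul_of_nonneg_left (ha.succ_le v i) hk
  · simp only [ha.periodic]
    push_cast
    ring
  · rw [loopSum_mul, hs]

theorem weightSums_mul (y k : ℕ) (mu : ℤ → ℤ) (nu : ℕ → ℕ) :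
    weightSums y (fun i => k * mu i) (fun v => k * nu v) = fun v => k * weightSums y mu nu v := by
  funext v
  simp [weightSums, loopSum_mul, mul_add, Finset.mul_sum]

theorem cylindric_kostka_saturation (x y : ℕ) (hx : 0 < x) (hy : 0 < y)
    (lam mu : ℤ → ℤ)
    (hlam : ∀ i, lam i ≤ lam (i + 1)) (hlamp : ∀ i, lam (i + y) = lam i + x)
    (hmu : ∀ i, mu i ≤ mu (i + 1)) (hmup : ∀ i, mu (i + y) = mu i + x)
    (hsub : ∀ i, mu i ≤ lam i)
    (nu : ℕ → ℕ) (k : ℕ) (hk : 0 < k) :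
    (∃ T, IsCylSSYT (k * x) y (fun i => k * lam i) (fun i => k * mu i)
        (fun v => k * nu v) T)
      ↔ (∃ T, IsCylSSYT x y lam mu nu T) := by
  have hk' : (0 : ℤ) ≤ k := Int.natCast_nonneg k
  have hp : ∀ {f : ℤ → ℤ}, (∀ i, f (i + y) = f i + x) →
      ∀ i, (k : ℤ) * f (i + y) = k * f i + ((k * x : ℕ) : ℤ) := fun h i => by
    rw [h]
    push_cast
    ring
  constructor
  · rintro ⟨T, hT⟩
    obtain ⟨n, hn⟩ := hT.exists_chainSums hy
      (fun i => mul_le_mul_of_nonneg_left (hlam i) hk') (hp hlamp)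
      (fun i => mul_le_mul_of_nonneg_left (hmu i) hk') (hp hmup)
      (fun i => mul_le_mul_of_nonneg_left (hsub i) hk')
    rw [weightSums_mul] at hn
    exact (hn.of_mul hy hlam hlamp hmu hmup hsub hk).exists_isCylSSYT hlamp hmup
  · rintro ⟨T, hT⟩
    obtain ⟨n, hn⟩ := hT.exists_chainSums hy hlam hlamp hmu hmup hsub
    have := hn.mul k
    rw [← weightSums_mul] at this
    exact this.exists_isCylSSYT (hp hlamp) (hp hmup)
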